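/- arXiv:1910.07624 — 2 statements merged into one kernel-verified Lean document; each statement's English description precedes it below -/
import Mathlib

section
/- The subgroup Γ of Sp(4,ℤ) generated by the four matrices A, B, C, D has index 6 in Sp(4,ℤ). -/
open Matrix

namespace GenusTwo

def A : Matrix (Fin 4) (Fin 4) ℤ := !![1,0,0,0; 0,1,0,0; 1,0,1,0; 0,0,0,1]
def B : Matrix (Fin 4) (Fin 4) ℤ := !![1,0,-1,1; 0,1,1,-1; 0,0,1,0; 0,0,0,1]
def C : Matrix (Fin 4) (Fin 4) ℤ := !![1,0,0,0; 0,1,0,0; 0,0,1,0; 0,1,0,1]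
def D : Matrix (Fin 4) (Fin 4) ℤ := !![1,0,0,0; 0,1,0,-1; 0,0,1,0; 0,0,0,1]
def E : Matrix (Fin 4) (Fin 4) ℤ := !![1,0,0,0; 0,1,0,0; 1,1,1,0; 1,1,0,1]

/-- View a `4 × 4` integer matrix as a matrix indexed by `Fin 2 ⊕ Fin 2`, so that it can be
compared with elements of Mathlib's symplectic group `Matrix.symplecticGroup (Fin 2) ℤ`. -/
def r (M : Matrix (Fin 4) (Fin 4) ℤ) : Matrix (Fin 2 ⊕ Fin 2) (Fin 2 ⊕ Fin 2) ℤ :=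
  Matrix.reindex finSumFinEquiv.symm finSumFinEquiv.symm M

/-- The subgroup `Γ` of `Sp(4,ℤ)` generated by the matrices `A`, `B`, `C`, `D`. -/
def Γ : Subgroup (Matrix.symplecticGroup (Fin 2) ℤ) :=
  Subgroup.closure {g | (g : Matrix (Fin 2 ⊕ Fin 2) (Fin 2 ⊕ Fin 2) ℤ) = r A ∨
    (g : Matrix (Fin 2 ⊕ Fin 2) (Fin 2 ⊕ Fin 2) ℤ) = r B ∨
    (g : Matrix (Fin 2 ⊕ Fin 2) (Fin 2 ⊕ Fin 2) ℤ) = r C ∨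
    (g : Matrix (Fin 2 ⊕ Fin 2) (Fin 2 ⊕ Fin 2) ℤ) = r D}

/-- The entrywise reduction homomorphism `Sp(4,ℤ) → Sp(4,ℤ/2ℤ)`. -/
def sred : Matrix.symplecticGroup (Fin 2) ℤ →* Matrix.symplecticGroup (Fin 2) (ZMod 2) where
  toFun g := ⟨(Int.castRingHom (ZMod 2)).mapMatrix
      (g : Matrix (Fin 2 ⊕ Fin 2) (Fin 2 ⊕ Fin 2) ℤ), by
    rw [SymplecticGroup.mem_iff]
    have hg := SymplecticGroup.mem_iff.mp g.2
    have hneg : ((-1 : Matrix (Fin 2) (Fin 2) ℤ).map fun x => ((x : ZMod 2))) = -1 := by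
      ext i j
      simp [Matrix.map_apply, Matrix.one_apply, apply_ite (Int.cast : ℤ → ZMod 2)]
    have hJ : (Int.castRingHom (ZMod 2)).mapMatrix (Matrix.J (Fin 2) ℤ) =
        Matrix.J (Fin 2) (ZMod 2) := by
      rw [RingHom.mapMatrix_apply]
      unfold Matrix.J
      rw [Matrix.fromBlocks_map]
      simp [hneg]
    rw [← hJ, RingHom.mapMatrix_apply, RingHom.mapMatrix_apply, ← Matrix.transpose_map,
      ← Matrix.map_mul, ← Matrix.map_mul, hg]⟩
  map_one' := by
    apply Subtype.ext
    simp
  map_mul' g h := by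
    apply Subtype.ext
    show ((g : Matrix (Fin 2 ⊕ Fin 2) (Fin 2 ⊕ Fin 2) ℤ) *
        (h : Matrix (Fin 2 ⊕ Fin 2) (Fin 2 ⊕ Fin 2) ℤ)).map (Int.castRingHom (ZMod 2)) = _
    rw [Matrix.map_mul]
    rfl

/-- The principal congruence subgroup `Γ(2)`: the kernel of the entrywise reduction
homomorphism `Sp(4,ℤ) → Sp(4,ℤ/2ℤ)`. -/
def Γ₂ : Subgroup (Matrix.symplecticGroup (Fin 2) ℤ) := sred.ker


abbrev G := Matrix.symplecticGroup (Fin 2) ℤ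

set_option maxRecDepth 100000

def c1 : G := ⟨r A, by rw [SymplecticGroup.mem_iff]; decide +kernel⟩
def c2 : G := ⟨r B, by rw [SymplecticGroup.mem_iff]; decide +kernel⟩
def c3 : G := ⟨r C, by rw [SymplecticGroup.mem_iff]; decide +kernel⟩
def c4 : G := ⟨r D, by rw [SymplecticGroup.mem_iff]; decide +kernel⟩
def c5 : G := ⟨r E, by rw [SymplecticGroup.mem_iff]; decide +kernel⟩

def w : G := c1 * c2 * c3 * c4

/-- The hyperelliptic relation, in the form used below. -/
lemma hyper : (w * w) * (w * w) * w = w * (c5 * c5) * (c4 * c3 * c2 * c1) :=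
  Subtype.ext (by decide +kernel)

lemma c1_mem : c1 ∈ Γ := Subgroup.subset_closure (Or.inl rfl)
lemma c2_mem : c2 ∈ Γ := Subgroup.subset_closure (Or.inr (Or.inl rfl))
lemma c3_mem : c3 ∈ Γ := Subgroup.subset_closure (Or.inr (Or.inr (Or.inl rfl)))
lemma c4_mem : c4 ∈ Γ := Subgroup.subset_closure (Or.inr (Or.inr (Or.inr rfl)))

lemma w_mem : w ∈ Γ := mul_mem (mul_mem (mul_mem c1_mem c2_mem) c3_mem) c4_mem

lemma c5sq_mem : c5 * c5 ∈ Γ := by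
  have h : c5 * c5 = w⁻¹ * ((w * w) * (w * w) * w) * (c4 * c3 * c2 * c1)⁻¹ := by
    rw [hyper]; group
  rw [h]
  have := w_mem
  exact mul_mem (mul_mem (inv_mem this) (mul_mem (mul_mem (mul_mem this this) (mul_mem this this))
    this)) (inv_mem (mul_mem (mul_mem (mul_mem c4_mem c3_mem) c2_mem) c1_mem))

/-- Coset representatives. -/
def R : Fin 6 → G :=
  ![1, c5, c4 * c5, c3 * (c4 * c5), c2 * (c3 * (c4 * c5)), c1 * (c2 * (c3 * (c4 * c5)))]

def q (x : Fin 2 ⊕ Fin 2 → ZMod 2) : ZMod 2 :=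
  x (.inl 0) * x (.inr 0) + x (.inl 1) * x (.inr 1) + x (.inl 1) + x (.inr 0) + x (.inr 1)

def red (g : G) : Matrix (Fin 2 ⊕ Fin 2) (Fin 2 ⊕ Fin 2) (ZMod 2) := (sred g).1

lemma red_mul (g h : G) : red (g * h) = red g * red h := by
  simp [red]

/-- The stabilizer of the odd quadratic form `q` modulo two. -/
def P : Subgroup G where
  carrier := {g | ∀ x, q (red g *ᵥ x) = q x}
  mul_mem' := by
    intro a b ha hb x
    rw [red_mul, ← Matrix.mulVec_mulVec, ha, hb]
  one_mem' := by
    intro x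
    simp [red]
  inv_mem' := by
    intro a ha x
    rw [← ha, Matrix.mulVec_mulVec, ← red_mul]
    simp [red]

lemma Γ_le_P : Γ ≤ P := by
  rw [Γ, Subgroup.closure_le]
  rintro g (h | h | h | h)
  · have : g = c1 := Subtype.ext h
    subst this
    show ∀ x, q (red c1 *ᵥ x) = q x
    decide +kernel
  · have : g = c2 := Subtype.ext h
    subst this
    show ∀ x, q (red c2 *ᵥ x) = q x
    decide +kernel
  · have : g = c3 := Subtype.ext h
    subst this
    show ∀ x, q (red c3 *ᵥ x) = q x
    decide +kernel
  · have : g = c4 := Subtype.ext h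
    subst this
    show ∀ x, q (red c4 *ᵥ x) = q x
    decide +kernel

lemma R_inj_aux : ∀ i j : Fin 6, (∀ x, q (red ((R i)⁻¹ * R j) *ᵥ x) = q x) → i = j := by
  decide +kernel

lemma R_inj (i j : Fin 6) (h : (R i)⁻¹ * R j ∈ Γ) : i = j := R_inj_aux i j (Γ_le_P h)

lemma smul_aux (g a b h : G) (hh : h ∈ Γ) (e : g * a = b * h) :
    g • (a : G ⧸ Γ) = (b : G ⧸ Γ) := by
  show ((g * a : G) : G ⧸ Γ) = b
  rw [e]
  exact QuotientGroup.mk_mul_of_mem b hh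

open scoped Pointwise

def X : Set (G ⧸ Γ) := Set.range fun i => (R i : G ⧸ Γ)

def K : Subgroup G := MulAction.stabilizer G X

lemma mem_K (g : G) (h : ∀ i, ∃ j, ∃ k ∈ Γ, g * R i = R j * k) : g ∈ K := by
  have hf : X.Finite := Set.finite_range _
  rw [K, MulAction.mem_stabilizer_set_iff_smul_set_subset hf]
  rintro _ ⟨_, ⟨i, rfl⟩, rfl⟩
  obtain ⟨j, k, hk, e⟩ := h i
  exact ⟨j, (smul_aux g _ _ k hk e).symm⟩

lemma conj_mem {u : G} (h : u ∈ Γ) : u * (c5 * c5) * u⁻¹ ∈ Γ :=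
  mul_mem (mul_mem h c5sq_mem) (inv_mem h)

lemma K1 : c1 ∈ K := by
  apply mem_K
  intro i
  fin_cases i
  · exact ⟨0, c1, c1_mem, Subtype.ext (by decide +kernel)⟩
  · exact ⟨1, c1, c1_mem, Subtype.ext (by decide +kernel)⟩
  · exact ⟨2, c1, c1_mem, Subtype.ext (by decide +kernel)⟩
  · exact ⟨3, c1, c1_mem, Subtype.ext (by decide +kernel)⟩
  · exact ⟨5, 1, one_mem _, Subtype.ext (by decide +kernel)⟩
  · exact ⟨4, _, conj_mem (u := c1 * c2 * c3 * c4) (mul_mem (mul_mem (mul_mem c1_mem c2_mem) c3_mem) c4_mem), by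
      rw [← mul_assoc, ← mul_assoc, eq_mul_inv_iff_mul_eq]
      exact Subtype.ext (by decide +kernel)⟩

lemma K2 : c2 ∈ K := by
  apply mem_K
  intro i
  fin_cases i
  · exact ⟨0, c2, c2_mem, Subtype.ext (by decide +kernel)⟩
  · exact ⟨1, c2, c2_mem, Subtype.ext (by decide +kernel)⟩
  · exact ⟨2, c2, c2_mem, Subtype.ext (by decide +kernel)⟩
  · exact ⟨4, 1, one_mem _, Subtype.ext (by decide +kernel)⟩
  · exact ⟨3, _, conj_mem (u := c2 * c3 * c4) (mul_mem (mul_mem c2_mem c3_mem) c4_mem), by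
      rw [← mul_assoc, ← mul_assoc, eq_mul_inv_iff_mul_eq]
      exact Subtype.ext (by decide +kernel)⟩
  · exact ⟨5, c1, c1_mem, Subtype.ext (by decide +kernel)⟩

lemma K3 : c3 ∈ K := by
  apply mem_K
  intro i
  fin_cases i
  · exact ⟨0, c3, c3_mem, Subtype.ext (by decide +kernel)⟩
  · exact ⟨1, c3, c3_mem, Subtype.ext (by decide +kernel)⟩
  · exact ⟨3, 1, one_mem _, Subtype.ext (by decide +kernel)⟩
  · exact ⟨2, _, conj_mem (u := c3 * c4) (mul_mem c3_mem c4_mem), by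
      rw [← mul_assoc, ← mul_assoc, eq_mul_inv_iff_mul_eq]
      exact Subtype.ext (by decide +kernel)⟩
  · exact ⟨4, c2, c2_mem, Subtype.ext (by decide +kernel)⟩
  · exact ⟨5, c2, c2_mem, Subtype.ext (by decide +kernel)⟩

lemma K4 : c4 ∈ K := by
  apply mem_K
  intro i
  fin_cases i
  · exact ⟨0, c4, c4_mem, Subtype.ext (by decide +kernel)⟩
  · exact ⟨2, 1, one_mem _, Subtype.ext (by decide +kernel)⟩
  · exact ⟨1, _, conj_mem (u := c4) c4_mem, by
      rw [← mul_assoc, ← mul_assoc, eq_mul_inv_iff_mul_eq]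
      exact Subtype.ext (by decide +kernel)⟩
  · exact ⟨3, c3, c3_mem, Subtype.ext (by decide +kernel)⟩
  · exact ⟨4, c3, c3_mem, Subtype.ext (by decide +kernel)⟩
  · exact ⟨5, c3, c3_mem, Subtype.ext (by decide +kernel)⟩

lemma K5 : c5 ∈ K := by
  apply mem_K
  intro i
  fin_cases i
  · exact ⟨1, 1, one_mem _, Subtype.ext (by decide +kernel)⟩
  · exact ⟨0, c5 * c5, c5sq_mem, Subtype.ext (by decide +kernel)⟩
  · exact ⟨2, c4, c4_mem, Subtype.ext (by decide +kernel)⟩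
  · exact ⟨3, c4, c4_mem, Subtype.ext (by decide +kernel)⟩
  · exact ⟨4, c4, c4_mem, Subtype.ext (by decide +kernel)⟩
  · exact ⟨5, c4, c4_mem, Subtype.ext (by decide +kernel)⟩


/-! ### Three copies of `SL(2,ℤ)` in `Sp(4,ℤ)` -/

abbrev SL := Matrix.SpecialLinearGroup (Fin 2) ℤ

lemma mem_G_iff (a b c d e f g h i j k l m n o p : ℤ) :
    fromBlocks !![a, b; e, f] !![c, d; g, h] !![i, j; m, n] !![k, l; o, p] ∈
      Matrix.symplecticGroup (Fin 2) ℤ ↔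
    (a * j + e * n = i * b + m * f ∧ c * l + g * p = k * d + o * h ∧
      a * k + e * o - (i * c + m * g) = 1 ∧ a * l + e * p - (i * d + m * h) = 0 ∧
      b * k + f * o - (j * c + n * g) = 0 ∧ b * l + f * p - (j * d + n * h) = 1) := by
  rw [SymplecticGroup.fromBlocks_mem_iff]
  simp only [← Matrix.ext_iff, Fin.forall_fin_two]
  simp [Matrix.mul_apply, Fin.sum_univ_two]
  constructor
  · rintro ⟨⟨h1, h2⟩, ⟨h3, h4⟩, ⟨h5, h6⟩, h7, h8⟩
    refine ⟨?_, ?_, ?_, ?_, ?_, ?_⟩ <;> linarith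
  · rintro ⟨h1, h2, h3, h4, h5, h6⟩
    refine ⟨⟨⟨?_, ?_⟩, ?_, ?_⟩, ⟨⟨?_, ?_⟩, ?_, ?_⟩, ⟨?_, ?_⟩, ?_, ?_⟩ <;> linarith

lemma sl_det (g : SL) : g 0 0 * g 1 1 - g 0 1 * g 1 0 = 1 := by
  rw [← Matrix.det_fin_two]; exact g.2

def φa : SL →* G := MonoidHom.mk'
  (fun g => ⟨fromBlocks !![g 0 0, 0; 0, 1] !![g 0 1, 0; 0, 0] !![g 1 0, 0; 0, 0]
    !![g 1 1, 0; 0, 1], by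
      have := sl_det g
      rw [mem_G_iff]; refine ⟨?_, ?_, ?_, ?_, ?_, ?_⟩ <;> linarith⟩)
  (by
    intro g h
    apply Subtype.ext
    simp [fromBlocks_multiply, Matrix.mul_apply, Fin.sum_univ_two])

def φb : SL →* G := MonoidHom.mk'
  (fun g => ⟨fromBlocks !![1, 0; 0, g 0 0] !![0, 0; 0, g 0 1] !![0, 0; 0, g 1 0]
    !![1, 0; 0, g 1 1], by
      have := sl_det g
      rw [mem_G_iff]; refine ⟨?_, ?_, ?_, ?_, ?_, ?_⟩ <;> linarith⟩)
  (by
    intro g h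
    apply Subtype.ext
    simp [fromBlocks_multiply, Matrix.mul_apply, Fin.sum_univ_two])

def φd : SL →* G := MonoidHom.mk'
  (fun g => ⟨fromBlocks !![g 0 0, g 0 1; g 1 0, g 1 1] !![0, 0; 0, 0] !![0, 0; 0, 0]
    !![g 1 1, - g 1 0; - g 0 1, g 0 0], by
      have := sl_det g
      rw [mem_G_iff]; refine ⟨?_, ?_, ?_, ?_, ?_, ?_⟩ <;> linarith⟩)
  (by
    intro g h
    apply Subtype.ext
    simp [fromBlocks_multiply, Matrix.mul_apply, Fin.sum_univ_two]
    constructor <;> ring)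

lemma φ_mem (φ : SL →* G) (hS : φ ModularGroup.S ∈ K) (hT : φ ModularGroup.T ∈ K) (g : SL) :
    φ g ∈ K := by
  have h : Subgroup.closure {ModularGroup.S, ModularGroup.T} ≤ K.comap φ := by
    rw [Subgroup.closure_le]
    rintro _ (rfl | rfl)
    · exact hS
    · exact hT
  rw [_root_.SpecialLinearGroup.SL2Z_generators] at h
  exact h (Subgroup.mem_top g)

lemma aT_mem : φa ModularGroup.T ∈ K := by
  have h : (c5 * c4 * c3 * c2) * c1⁻¹ = φa ModularGroup.T * (c5 * c4 * c3 * c2) :=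
    Subtype.ext (by decide +kernel)
  have hu : c5 * c4 * c3 * c2 ∈ K := mul_mem (mul_mem (mul_mem K5 K4) K3) K2
  rw [← mul_inv_eq_iff_eq_mul] at h
  rw [← h]
  exact mul_mem (mul_mem hu (inv_mem K1)) (inv_mem hu)

lemma aS_mem : φa ModularGroup.S ∈ K := by
  have h : φa ModularGroup.S = (φa ModularGroup.T)⁻¹ * c1 * (φa ModularGroup.T)⁻¹ :=
    Subtype.ext (by decide +kernel)
  rw [h]
  exact mul_mem (mul_mem (inv_mem aT_mem) K1) (inv_mem aT_mem)

lemma bT_mem : φb ModularGroup.T ∈ K := by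
  have h : φb ModularGroup.T = c4⁻¹ := Subtype.ext (by decide +kernel)
  rw [h]
  exact inv_mem K4

lemma bS_mem : φb ModularGroup.S ∈ K := by
  have h : φb ModularGroup.S = c4 * c3 * c4 := Subtype.ext (by decide +kernel)
  rw [h]
  exact mul_mem (mul_mem K4 K3) K4

lemma dT_mem : φd ModularGroup.T ∈ K := by
  have h : φd ModularGroup.T =
      (c1 * c3 * c5⁻¹) * (φa ModularGroup.T * c5 * c1⁻¹ * (φa ModularGroup.T)⁻¹) :=
    Subtype.ext (by decide +kernel)
  rw [h]
  exact mul_mem (mul_mem (mul_mem K1 K3) (inv_mem K5)) (mul_mem (mul_mem (mul_mem aT_mem K5)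
    (inv_mem K1)) (inv_mem aT_mem))

lemma dS_mem : φd ModularGroup.S ∈ K := by
  have h : φd ModularGroup.T * φd ModularGroup.S * φd ModularGroup.T =
      (c1 * c3 * c4 * c3) * (c3 * c4 * c5)⁻¹ :=
    Subtype.ext (by decide +kernel)
  have h' : φd ModularGroup.S = (φd ModularGroup.T)⁻¹ *
      ((c1 * c3 * c4 * c3) * (c3 * c4 * c5)⁻¹) * (φd ModularGroup.T)⁻¹ := by
    rw [← h]; group
  rw [h']
  exact mul_mem (mul_mem (inv_mem dT_mem) (mul_mem (mul_mem (mul_mem (mul_mem K1 K3) K4) K3)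
    (inv_mem (mul_mem (mul_mem K3 K4) K5)))) (inv_mem dT_mem)

lemma a_mem (g : SL) : φa g ∈ K := φ_mem φa aS_mem aT_mem g
lemma b_mem (g : SL) : φb g ∈ K := φ_mem φb bS_mem bT_mem g
lemma d_mem (g : SL) : φd g ∈ K := φ_mem φd dS_mem dT_mem g

/-! ### Column reduction -/

lemma bez (a c : ℤ) : ∃ g : SL, g 1 0 * a + g 1 1 * c = 0 := by
  by_cases hd : Int.gcd a c = 0
  · rw [Int.gcd_eq_zero_iff] at hd
    exact ⟨1, by simp [hd.1, hd.2]⟩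
  · obtain ⟨a', ha⟩ := Int.gcd_dvd_left a c
    obtain ⟨c', hc⟩ := Int.gcd_dvd_right a c
    have hb := Int.gcd_eq_gcd_ab a c
    have hd' : (Int.gcd a c : ℤ) ≠ 0 := by exact_mod_cast hd
    set d : ℤ := (Int.gcd a c : ℤ) with hdd
    set u := Int.gcdA a c
    set v := Int.gcdB a c
    refine ⟨⟨!![u, v; -c', a'], ?_⟩, ?_⟩
    · rw [Matrix.det_fin_two_of]
      apply mul_left_cancel₀ hd'
      linear_combination u * (-ha) + v * (-hc) - hb
    · show -c' * a + a' * c = 0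
      linear_combination (-c') * ha + a' * hc

lemma final (M : G) (h0 : M.1 (.inl 0) (.inl 0) = 1) (h1 : M.1 (.inl 1) (.inl 0) = 0)
    (h2 : M.1 (.inr 0) (.inl 0) = 0) (h3 : M.1 (.inr 1) (.inl 0) = 0) : M ∈ K := by
  obtain ⟨M, hM⟩ := M
  obtain ⟨a, b, c, d, e, f, g, h, i, j, k, l, m, n, o, p, rfl⟩ :
    ∃ a b c d e f g h i j k l m n o p : ℤ,
      M = fromBlocks !![a, b; e, f] !![c, d; g, h] !![i, j; m, n] !![k, l; o, p] :=
    ⟨_, _, _, _, _, _, _, _, _, _, _, _, _, _, _, _, by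
      conv_lhs => rw [← Matrix.fromBlocks_toBlocks M]
      congr 1 <;> exact Matrix.eta_fin_two _⟩
  simp at h0 h1 h2 h3
  subst h0 h1 h2 h3
  have hM' := hM
  rw [mem_G_iff] at hM'
  obtain ⟨e1, e2, e3, e4, e5, e6⟩ := hM'
  have hj : j = 0 := by linarith
  have hk : k = 1 := by linarith
  have hl : l = 0 := by linarith
  subst hj hk hl
  let B : SL := ⟨!![f, h; n, p], by rw [Matrix.det_fin_two_of]; linarith⟩
  let U : ℤ → SL := fun t => ⟨!![1, t; 0, 1], by simp [Matrix.det_fin_two_of]⟩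
  have hfp : f * p - n * h = 1 := by linarith
  have hg : g = f * d - h * b := by linear_combination (-g) * hfp + f * e2 + h * e5
  have ho : o = n * d - p * b := by linear_combination (-o) * hfp + p * e5 + n * e2
  let V : SL := ⟨!![0, -1; 1, 0], by simp [Matrix.det_fin_two_of]⟩
  let V' : SL := ⟨!![0, 1; -1, 0], by simp [Matrix.det_fin_two_of]⟩
  have key : (⟨_, hM⟩ : G) = φb B * (φa (U (c + b * d)) * (φb V * φd (U d) * φb V') *
      φd (U b)) := by
    apply Subtype.ext
    simp only [φb, φa, φd, B, U, V, V', Submonoid.coe_mul, MonoidHom.mk'_apply,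
      fromBlocks_multiply, Matrix.SpecialLinearGroup.coe_mk]
    simp only [Matrix.of_apply, Matrix.cons_val', Matrix.cons_val_zero, Matrix.cons_val_one,
      Matrix.cons_val_fin_one, Matrix.mul_fin_two, Matrix.fromBlocks_multiply, Matrix.of_add_of,
      Matrix.add_cons, Matrix.cons_add_cons, Matrix.empty_add_empty]
    rw [hg, ho]
    congr 1 <;> ext i j <;> fin_cases i <;> fin_cases j <;> simp <;> ring
  rw [key]
  exact mul_mem (b_mem _) (mul_mem (mul_mem (a_mem _) (mul_mem (mul_mem (b_mem _) (d_mem _))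
    (b_mem _))) (d_mem _))

lemma all_mem (M : G) : M ∈ K := by
  obtain ⟨g1, hg1⟩ := bez (M.1 (.inl 0) (.inl 0)) (M.1 (.inr 0) (.inl 0))
  rw [← Subgroup.mul_mem_cancel_left K (a_mem g1)]
  have z1 : (φa g1 * M).1 (.inr 0) (.inl 0) = 0 := by
    rw [← hg1]
    simp [φa, Matrix.mul_apply, Fin.sum_univ_two]
  generalize φa g1 * M = M at z1
  obtain ⟨g2, hg2⟩ := bez (M.1 (.inl 1) (.inl 0)) (M.1 (.inr 1) (.inl 0))
  rw [← Subgroup.mul_mem_cancel_left K (b_mem g2)]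
  have z2 : (φb g2 * M).1 (.inr 1) (.inl 0) = 0 := by
    rw [← hg2]
    simp [φb, Matrix.mul_apply, Fin.sum_univ_two]
  replace z1 : (φb g2 * M).1 (.inr 0) (.inl 0) = 0 := by
    simp [φb, Matrix.mul_apply, Fin.sum_univ_two, z1]
  generalize φb g2 * M = M at z1 z2
  obtain ⟨g3, hg3⟩ := bez (M.1 (.inl 0) (.inl 0)) (M.1 (.inl 1) (.inl 0))
  rw [← Subgroup.mul_mem_cancel_left K (d_mem g3)]
  have z3 : (φd g3 * M).1 (.inl 1) (.inl 0) = 0 := by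
    rw [← hg3]
    simp [φd, Matrix.mul_apply, Fin.sum_univ_two, z1, z2]
  replace z1 : (φd g3 * M).1 (.inr 0) (.inl 0) = 0 ∧ (φd g3 * M).1 (.inr 1) (.inl 0) = 0 := by
    simp [φd, Matrix.mul_apply, Fin.sum_univ_two, z1, z2]
  obtain ⟨z1, z2⟩ := z1
  generalize φd g3 * M = M at z1 z2 z3
  have hs := congrFun (congrFun (SymplecticGroup.mem_iff'.1 M.2) (.inl 0)) (.inr 0)
  simp [Matrix.mul_apply, Fin.sum_univ_two, Matrix.J, z1, z2, z3] at hs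
  rcases Int.isUnit_iff.1 (IsUnit.of_mul_eq_one _ hs) with h | h
  · exact final M h z3 z1 z2
  · rw [← Subgroup.mul_mem_cancel_left K (a_mem (-1))]
    apply final <;> simp [φa, Matrix.mul_apply, Fin.sum_univ_two, z1, z2, z3, h]

lemma R_bij : Function.Bijective fun i => (R i : G ⧸ Γ) := by
  constructor
  · intro i j h
    exact R_inj i j (QuotientGroup.eq.1 h)
  · intro y
    induction y using QuotientGroup.induction_on with
    | H g =>
      have h : g • X = X := all_mem g
      have h1 : ((1 : G) : G ⧸ Γ) ∈ X := ⟨0, rfl⟩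
      have h2 := Set.smul_mem_smul_set (a := g) h1
      rw [h] at h2
      have h3 : g • ((1 : G) : G ⧸ Γ) = (g : G ⧸ Γ) := by
        show ((g * 1 : G) : G ⧸ Γ) = g
        rw [mul_one]
      rw [h3] at h2
      exact h2

/-- The subgroup `Γ` of `Sp(4,ℤ)` generated by the four matrices `A`, `B`, `C`, `D`
has index `6` in `Sp(4,ℤ)`. -/
theorem gamma_index_six : Γ.index = 6 := by
  rw [Subgroup.index, ← Nat.card_congr (Equiv.ofBijective _ R_bij), Nat.card_fin]

end GenusTwo
end

section
/- The congruence subgroup Γ(2) is a normal subgroup of Γ and the quotient group Γ/Γ(2) is isomorphic to the symmetric group S₅ on five letters; equivalently, the image of Γ under the reduction homomorphism Sp(4,ℤ) → Sp(4,ℤ/2ℤ) is a group of order 120 isomorphic to S₅. -/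
open Matrix

namespace GenusTwo


instance : Γ₂.Normal := sred.normal_ker



/-! ### Euclidean algorithm on integer vectors by even elementary operations -/

lemma exists_even_reduce (a b : ℤ) (ha : a ≠ 0) : ∃ k : ℤ, |b + 2 * k * a| ≤ |a| := by
  have h2 : (2 * a) ≠ 0 := by omega
  have h1 := Int.emod_nonneg b h2
  have h3 := Int.emod_lt_abs b h2
  have h4 := Int.emod_add_mul_ediv b (2 * a)
  have h5 : |2 * a| = 2 * |a| := by rw [abs_mul]; norm_num
  rw [h5] at h3
  by_cases hc : b % (2 * a) ≤ |a|
  · refine ⟨-(b / (2 * a)), ?_⟩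
    have : b + 2 * -(b / (2 * a)) * a = b % (2 * a) := by linear_combination -h4
    rw [this, abs_of_nonneg h1]
    exact hc
  · rcases abs_cases a with ⟨e, _⟩ | ⟨e, _⟩
    · refine ⟨-(b / (2 * a)) - 1, ?_⟩
      have : b + 2 * (-(b / (2 * a)) - 1) * a = b % (2 * a) - 2 * a := by
        linear_combination -h4
      rw [this, abs_le]
      constructor <;> omega
    · refine ⟨-(b / (2 * a)) + 1, ?_⟩
      have : b + 2 * (-(b / (2 * a)) + 1) * a = b % (2 * a) + 2 * a := by
        linear_combination -h4
      rw [this, abs_le]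
      constructor <;> omega

/-- Parity makes the inequality strict. -/
lemma exists_even_reduce_lt (a b : ℤ) (ha : Odd a) (hb : Even b) :
    ∃ k : ℤ, |b + 2 * k * a| < |a| := by
  have h0 : a ≠ 0 := by rintro rfl; simp at ha
  obtain ⟨k, hk⟩ := exists_even_reduce a b h0
  refine ⟨k, lt_of_le_of_ne hk ?_⟩
  intro he
  have h1 : Even (b + 2 * k * a) := hb.add ((even_two_mul k).mul_right a)
  have h2 : Even |b + 2 * k * a| := even_abs.2 h1
  rw [he, even_abs] at h2
  exact (Int.not_even_iff_odd.2 ha) h2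

lemma even_add_two (b k c : ℤ) (hb : Even b) : Even (b + 2 * k * c) :=
  hb.add ((even_two_mul k).mul_right c)

lemma odd_add_two (b k c : ℤ) (hb : Odd b) : Odd (b + 2 * k * c) :=
  hb.add_even ((even_two_mul k).mul_right c)

lemma natAbs_lt_aux {a b c : ℤ} {n : ℕ} (h1 : |a| ≤ |b|) (h2 : |b| < |c|) (hn : c.natAbs = n) :
    a.natAbs < n := by
  rw [← hn]
  exact Int.natAbs_lt_iff_sq_lt.2 (sq_lt_sq.2 (lt_of_le_of_lt h1 h2))

lemma euclid_four (Q : ℤ → ℤ → ℤ → ℤ → Prop)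
    (l1 : ∀ k x₁ x₂ y₁ y₂, Q (x₁ + 2 * k * y₁) x₂ y₁ y₂ → Q x₁ x₂ y₁ y₂)
    (l2 : ∀ k x₁ x₂ y₁ y₂, Q x₁ x₂ (y₁ + 2 * k * x₁) y₂ → Q x₁ x₂ y₁ y₂)
    (s1 : ∀ k x₁ x₂ y₁ y₂, Q (x₁ + 2 * k * x₂) x₂ y₁ (y₂ + 2 * (-k) * y₁) → Q x₁ x₂ y₁ y₂)
    (s2 : ∀ k x₁ x₂ y₁ y₂, Q x₁ (x₂ + 2 * k * x₁) (y₁ + 2 * (-k) * y₂) y₂ → Q x₁ x₂ y₁ y₂)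
    (s3 : ∀ k x₁ x₂ y₁ y₂, Q (x₁ + 2 * k * y₂) (x₂ + 2 * k * y₁) y₁ y₂ → Q x₁ x₂ y₁ y₂)
    (s4 : ∀ k x₁ x₂ y₁ y₂, Q x₁ x₂ (y₁ + 2 * k * x₂) (y₂ + 2 * k * x₁) → Q x₁ x₂ y₁ y₂)
    (base : ∀ a, Q a 0 0 0) :
    ∀ n : ℕ, ∀ x₁ x₂ y₁ y₂ : ℤ, x₁.natAbs = n → Odd x₁ → Even x₂ → Even y₁ → Even y₂ →
      Q x₁ x₂ y₁ y₂ := by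
  intro n
  induction n using Nat.strong_induction_on with
  | _ n ih =>
    intro x₁ x₂ y₁ y₂ hn h1 h2 h3 h4
    obtain ⟨k, hk⟩ := exists_even_reduce_lt x₁ x₂ h1 h2
    apply s2 k
    replace h2 := even_add_two x₂ k x₁ h2
    replace h3 := even_add_two y₁ (-k) y₂ h3
    generalize x₂ + 2 * k * x₁ = x₂ at *
    generalize y₁ + 2 * (-k) * y₂ = y₁ at *
    obtain ⟨k, hk'⟩ := exists_even_reduce_lt x₁ y₂ h1 h4
    apply s4 k
    replace h4 := even_add_two y₂ k x₁ h4
    replace h3 := even_add_two y₁ k x₂ h3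
    generalize y₂ + 2 * k * x₁ = y₂ at *
    generalize y₁ + 2 * k * x₂ = y₁ at *
    obtain ⟨k, hk''⟩ := exists_even_reduce_lt x₁ y₁ h1 h3
    apply l2 k
    replace h3 := even_add_two y₁ k x₁ h3
    generalize y₁ + 2 * k * x₁ = y₁ at *
    by_cases c1 : y₁ = 0
    · by_cases c2 : x₂ = 0
      · by_cases c3 : y₂ = 0
        · subst c1 c2 c3
          exact base x₁
        · obtain ⟨k, hk⟩ := exists_even_reduce y₂ x₁ c3
          apply s3 k
          exact ih _ (natAbs_lt_aux hk (by assumption) hn) _ _ _ _ rfl (odd_add_two _ _ _ h1) (even_add_two _ _ _ h2) h3 h4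
      · obtain ⟨k, hk⟩ := exists_even_reduce x₂ x₁ c2
        apply s1 k
        exact ih _ (natAbs_lt_aux hk (by assumption) hn) _ _ _ _ rfl (odd_add_two _ _ _ h1) h2 h3 (even_add_two _ _ _ h4)
    · obtain ⟨k, hk⟩ := exists_even_reduce y₁ x₁ c1
      apply l1 k
      exact ih _ (natAbs_lt_aux hk (by assumption) hn) _ _ _ _ rfl (odd_add_two _ _ _ h1) h2 h3 h4

lemma euclid_two (Q : ℤ → ℤ → Prop)
    (l1 : ∀ k x y, Q (x + 2 * k * y) y → Q x y)
    (l2 : ∀ k x y, Q x (y + 2 * k * x) → Q x y)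
    (base : ∀ a, Q a 0) :
    ∀ n : ℕ, ∀ x y : ℤ, x.natAbs = n → Odd x → Even y → Q x y := by
  intro n
  induction n using Nat.strong_induction_on with
  | _ n ih =>
    intro x y hn h1 h2
    obtain ⟨k, hk⟩ := exists_even_reduce_lt x y h1 h2
    apply l2 k
    replace h2 := even_add_two y k x h2
    generalize y + 2 * k * x = y at *
    by_cases c1 : y = 0
    · subst c1
      exact base x
    · obtain ⟨k, hk⟩ := exists_even_reduce y x c1
      apply l1 k
      exact ih _ (natAbs_lt_aux hk (by assumption) hn) _ _ rfl (odd_add_two _ _ _ h1) h2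

/-! ### The elementary operations as elements of `Sp(4,ℤ)` -/

abbrev Sp := Matrix.symplecticGroup (Fin 2) ℤ

/-- `Sp(4,ℤ)` elements from blocks. -/
def mkSp (a b c d : Matrix (Fin 2) (Fin 2) ℤ)
    (h : aᵀ * c = cᵀ * a ∧ bᵀ * d = dᵀ * b ∧ aᵀ * d - cᵀ * b = 1) : Sp :=
  ⟨fromBlocks a b c d, SymplecticGroup.fromBlocks_mem_iff.2 h⟩

def gA : Sp := mkSp !![1,0;0,1] !![0,0;0,0] !![1,0;0,0] !![1,0;0,1] (by decide)
def gB : Sp := mkSp !![1,0;0,1] !![-1,1;1,-1] !![0,0;0,0] !![1,0;0,1] (by decide)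
def gC : Sp := mkSp !![1,0;0,1] !![0,0;0,0] !![0,0;0,1] !![1,0;0,1] (by decide)
def gD : Sp := mkSp !![1,0;0,1] !![0,0;0,-1] !![0,0;0,0] !![1,0;0,1] (by decide)

lemma gA_coe : (gA : Matrix (Fin 2 ⊕ Fin 2) (Fin 2 ⊕ Fin 2) ℤ) = r A := by decide
lemma gB_coe : (gB : Matrix (Fin 2 ⊕ Fin 2) (Fin 2 ⊕ Fin 2) ℤ) = r B := by decide
lemma gC_coe : (gC : Matrix (Fin 2 ⊕ Fin 2) (Fin 2 ⊕ Fin 2) ℤ) = r C := by decide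
lemma gD_coe : (gD : Matrix (Fin 2 ⊕ Fin 2) (Fin 2 ⊕ Fin 2) ℤ) = r D := by decide

lemma gens_eq : {g : Sp | (g : Matrix (Fin 2 ⊕ Fin 2) (Fin 2 ⊕ Fin 2) ℤ) = r A ∨
    (g : Matrix (Fin 2 ⊕ Fin 2) (Fin 2 ⊕ Fin 2) ℤ) = r B ∨
    (g : Matrix (Fin 2 ⊕ Fin 2) (Fin 2 ⊕ Fin 2) ℤ) = r C ∨
    (g : Matrix (Fin 2 ⊕ Fin 2) (Fin 2 ⊕ Fin 2) ℤ) = r D} = {gA, gB, gC, gD} := by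
  ext g
  simp only [Set.mem_ofPred_eq, Set.mem_insert_iff, Set.mem_singleton_iff, ← gA_coe, ← gB_coe,
    ← gC_coe, ← gD_coe, Subtype.ext_iff]

lemma Γ_eq : Γ = Subgroup.closure {gA, gB, gC, gD} := by
  rw [Γ, gens_eq]

lemma gA_mem : gA ∈ Γ := Γ_eq ▸ Subgroup.subset_closure (by simp)
lemma gB_mem : gB ∈ Γ := Γ_eq ▸ Subgroup.subset_closure (by simp)
lemma gC_mem : gC ∈ Γ := Γ_eq ▸ Subgroup.subset_closure (by simp)
lemma gD_mem : gD ∈ Γ := Γ_eq ▸ Subgroup.subset_closure (by simp)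

def up (p q s : ℤ) : Sp := mkSp 1 !![p,q;q,s] 0 1 (by
  refine ⟨by simp, ?_, by simp⟩
  ext i j; fin_cases i <;> fin_cases j <;> simp)
def lo (p q s : ℤ) : Sp := mkSp 1 0 !![p,q;q,s] 1 (by
  refine ⟨?_, by simp, by simp⟩
  ext i j; fin_cases i <;> fin_cases j <;> simp)
def sh1 (k : ℤ) : Sp := mkSp !![1,k;0,1] 0 0 !![1,0;-k,1] (by
  refine ⟨by simp, by simp, ?_⟩
  ext i j; fin_cases i <;> fin_cases j <;> simp [mul_apply])
def sh2 (k : ℤ) : Sp := mkSp !![1,0;k,1] 0 0 !![1,-k;0,1] (by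
  refine ⟨by simp, by simp, ?_⟩
  ext i j; fin_cases i <;> fin_cases j <;> simp [mul_apply])
def neg1 : Sp := mkSp !![-1,0;0,1] 0 0 !![-1,0;0,1] (by decide)
def neg2 : Sp := mkSp !![1,0;0,-1] 0 0 !![1,0;0,-1] (by decide)

lemma up_add (p q s p' q' s' : ℤ) : up p q s * up p' q' s' = up (p + p') (q + q') (s + s') := by
  apply Subtype.ext
  simp [up, mkSp, fromBlocks_multiply, add_comm]
lemma lo_add (p q s p' q' s' : ℤ) : lo p q s * lo p' q' s' = lo (p + p') (q + q') (s + s') := by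
  apply Subtype.ext
  simp [lo, mkSp, fromBlocks_multiply]
lemma sh1_add (p q : ℤ) : sh1 p * sh1 q = sh1 (p + q) := by
  apply Subtype.ext
  simp [sh1, mkSp, fromBlocks_multiply, add_comm]
lemma sh2_add (p q : ℤ) : sh2 p * sh2 q = sh2 (p + q) := by
  apply Subtype.ext
  simp [sh2, mkSp, fromBlocks_multiply, add_comm]

lemma fam_mem (f : ℤ → Sp) (hf : ∀ a b, f a * f b = f (a + b)) (h : f 1 ∈ Γ) (k : ℤ) :
    f k ∈ Γ := by
  have h0 : f 0 = 1 := by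
    have := hf 0 0
    simpa using this
  have hm : f (-1) ∈ Γ := by
    have : f (-1) = (f 1)⁻¹ := by
      rw [eq_inv_iff_mul_eq_one, hf]; simpa using h0
    rw [this]; exact Γ.inv_mem h
  induction k using Int.induction_on with
  | zero => rw [h0]; exact Γ.one_mem
  | succ i ih => rw [← hf]; exact Γ.mul_mem ih h
  | pred i ih => rw [sub_eq_add_neg, ← hf]; exact Γ.mul_mem ih hm

def w1 : Sp := gB * gC * gD
def w2 : Sp := gA * gB * gC
def w3 : Sp := gC * gD * gC
def w4 : Sp := gC * gD
def w5 : Sp := gA * gB * gC * gD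

lemma w1_mem : w1 ∈ Γ := Γ.mul_mem (Γ.mul_mem gB_mem gC_mem) gD_mem
lemma w2_mem : w2 ∈ Γ := Γ.mul_mem (Γ.mul_mem gA_mem gB_mem) gC_mem
lemma w3_mem : w3 ∈ Γ := Γ.mul_mem (Γ.mul_mem gC_mem gD_mem) gC_mem
lemma w4_mem : w4 ∈ Γ := Γ.mul_mem gC_mem gD_mem
lemma w5_mem : w5 ∈ Γ := Γ.mul_mem (Γ.mul_mem (Γ.mul_mem gA_mem gB_mem) gC_mem) gD_mem

lemma e_l1 : up (-2) 0 0 = w1 * w1 * (w1 * w1) := by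
  apply Subtype.ext; decide +kernel
lemma e_l2 : lo 2 0 0 = gA * gA := by
  apply Subtype.ext; decide +kernel
lemma e_l3 : up 0 0 (-2) = gD * gD := by
  apply Subtype.ext; decide +kernel
lemma e_l4 : lo 0 0 2 = gC * gC := by
  apply Subtype.ext; decide +kernel
lemma e_s3 : up (-2) 2 (-2) = gB * gB := by
  apply Subtype.ext; decide +kernel
lemma e_s4 : lo 2 2 2 = w2 * w2 * (w2 * w2) := by
  apply Subtype.ext; decide +kernel
lemma e_s1 : sh1 (-2) = w3 * up 0 2 0 * w3⁻¹ := by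
  rw [eq_mul_inv_iff_mul_eq]
  apply Subtype.ext; decide +kernel
lemma e_s2 : sh2 (-2) = w3 * lo 0 2 0 * w3⁻¹ := by
  rw [eq_mul_inv_iff_mul_eq]
  apply Subtype.ext; decide +kernel
lemma e_neg2 : neg2 = w4 * w4 * w4 := by
  apply Subtype.ext; decide +kernel
lemma e_neg1 : neg1 = w4 * w4 * w4 * (w5 * w5 * w5 * w5 * w5) := by
  apply Subtype.ext; decide +kernel

lemma neg2_mem : neg2 ∈ Γ := by
  rw [e_neg2]; exact Γ.mul_mem (Γ.mul_mem w4_mem w4_mem) w4_mem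
lemma neg1_mem : neg1 ∈ Γ := by
  rw [e_neg1]
  exact Γ.mul_mem (Γ.mul_mem (Γ.mul_mem w4_mem w4_mem) w4_mem)
    (Γ.mul_mem (Γ.mul_mem (Γ.mul_mem (Γ.mul_mem w5_mem w5_mem) w5_mem) w5_mem) w5_mem)

lemma l1_mem (k : ℤ) : up (2 * k) 0 0 ∈ Γ := by
  have := fam_mem (fun k => up (-2 * k) 0 0) (fun a b => by simp [up_add]; ring_nf)
    (by simp only [mul_one]; rw [e_l1]
        exact Γ.mul_mem (Γ.mul_mem w1_mem w1_mem) (Γ.mul_mem w1_mem w1_mem)) (-k)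
  simpa using this
lemma l2_mem (k : ℤ) : lo (2 * k) 0 0 ∈ Γ :=
  fam_mem (fun k => lo (2 * k) 0 0) (fun a b => by simp [lo_add]; ring_nf)
    (by simp only [mul_one]; rw [e_l2]; exact Γ.mul_mem gA_mem gA_mem) k
lemma l3_mem (k : ℤ) : up 0 0 (2 * k) ∈ Γ := by
  have := fam_mem (fun k => up 0 0 (-2 * k)) (fun a b => by simp [up_add]; ring_nf)
    (by simp only [mul_one]; rw [e_l3]; exact Γ.mul_mem gD_mem gD_mem) (-k)
  simpa using this
lemma l4_mem (k : ℤ) : lo 0 0 (2 * k) ∈ Γ :=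
  fam_mem (fun k => lo 0 0 (2 * k)) (fun a b => by simp [lo_add]; ring_nf)
    (by simp only [mul_one]; rw [e_l4]; exact Γ.mul_mem gC_mem gC_mem) k
lemma s3_mem1 : up 0 2 0 ∈ Γ := by
  have : up 0 2 0 = up (2 * 1) 0 0 * up 0 0 (2 * 1) * up (-2) 2 (-2) := by simp [up_add]
  rw [this, e_s3]
  exact Γ.mul_mem (Γ.mul_mem (l1_mem 1) (l3_mem 1)) (Γ.mul_mem gB_mem gB_mem)
lemma s4_mem1 : lo 0 2 0 ∈ Γ := by
  have : lo 0 2 0 = lo (2 * (-1)) 0 0 * lo 0 0 (2 * (-1)) * lo 2 2 2 := by simp [lo_add]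
  rw [this, e_s4]
  exact Γ.mul_mem (Γ.mul_mem (l2_mem _) (l4_mem _))
    (Γ.mul_mem (Γ.mul_mem w2_mem w2_mem) (Γ.mul_mem w2_mem w2_mem))
lemma s3_mem (k : ℤ) : up 0 (2 * k) 0 ∈ Γ :=
  fam_mem (fun k => up 0 (2 * k) 0) (fun a b => by simp [up_add]; ring_nf)
    (by simpa using s3_mem1) k
lemma s4_mem (k : ℤ) : lo 0 (2 * k) 0 ∈ Γ :=
  fam_mem (fun k => lo 0 (2 * k) 0) (fun a b => by simp [lo_add]; ring_nf)
    (by simpa using s4_mem1) k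
lemma s1_mem (k : ℤ) : sh1 (2 * k) ∈ Γ := by
  have := fam_mem (fun k => sh1 (-2 * k)) (fun a b => by simp [sh1_add]; ring_nf)
    (by simp only [mul_one]; rw [e_s1]
        exact Γ.mul_mem (Γ.mul_mem w3_mem s3_mem1) (Γ.inv_mem w3_mem)) (-k)
  simpa using this
lemma s2_mem (k : ℤ) : sh2 (2 * k) ∈ Γ := by
  have := fam_mem (fun k => sh2 (-2 * k)) (fun a b => by simp [sh2_add]; ring_nf)
    (by simp only [mul_one]; rw [e_s2]
        exact Γ.mul_mem (Γ.mul_mem w3_mem s4_mem1) (Γ.inv_mem w3_mem)) (-k)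
  simpa using this

/-! ### The principal congruence subgroup is contained in `Γ` -/

lemma mem_Γ₂_iff (g : Sp) : g ∈ Γ₂ ↔ ∀ i j, ((g.1 i j : ℤ) : ZMod 2) =
    (1 : Matrix (Fin 2 ⊕ Fin 2) (Fin 2 ⊕ Fin 2) (ZMod 2)) i j := by
  rw [Γ₂, MonoidHom.mem_ker, Subtype.ext_iff, ← Matrix.ext_iff]
  rfl

lemma two_zmod : (2 : ZMod 2) = 0 := rfl

lemma up_mem_Γ₂ (p q s : ℤ) (hp : Even p) (hq : Even q) (hs : Even s) : up p q s ∈ Γ₂ := by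
  rw [mem_Γ₂_iff]
  rintro (i | i) (j | j) <;> fin_cases i <;> fin_cases j <;>
    simp [up, mkSp, (ZMod.intCast_eq_zero_iff_even).2 hp, (ZMod.intCast_eq_zero_iff_even).2 hq,
      (ZMod.intCast_eq_zero_iff_even).2 hs]
lemma lo_mem_Γ₂ (p q s : ℤ) (hp : Even p) (hq : Even q) (hs : Even s) : lo p q s ∈ Γ₂ := by
  rw [mem_Γ₂_iff]
  rintro (i | i) (j | j) <;> fin_cases i <;> fin_cases j <;>
    simp [lo, mkSp, (ZMod.intCast_eq_zero_iff_even).2 hp, (ZMod.intCast_eq_zero_iff_even).2 hq,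
      (ZMod.intCast_eq_zero_iff_even).2 hs]
lemma sh1_mem_Γ₂ (p : ℤ) (hp : Even p) : sh1 p ∈ Γ₂ := by
  rw [mem_Γ₂_iff]
  rintro (i | i) (j | j) <;> fin_cases i <;> fin_cases j <;>
    simp [sh1, mkSp, (ZMod.intCast_eq_zero_iff_even).2 hp]
lemma sh2_mem_Γ₂ (p : ℤ) (hp : Even p) : sh2 p ∈ Γ₂ := by
  rw [mem_Γ₂_iff]
  rintro (i | i) (j | j) <;> fin_cases i <;> fin_cases j <;>
    simp [sh2, mkSp, (ZMod.intCast_eq_zero_iff_even).2 hp]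
lemma neg1_mem_Γ₂ : neg1 ∈ Γ₂ := by
  rw [mem_Γ₂_iff]
  rintro (i | i) (j | j) <;> fin_cases i <;> fin_cases j <;> simp [neg1, mkSp]
lemma neg2_mem_Γ₂ : neg2 ∈ Γ₂ := by
  rw [mem_Γ₂_iff]
  rintro (i | i) (j | j) <;> fin_cases i <;> fin_cases j <;> simp [neg2, mkSp]

def H : Subgroup Sp := Γ ⊓ Γ₂

lemma l1_H (k : ℤ) : up (2 * k) 0 0 ∈ H := ⟨l1_mem k, up_mem_Γ₂ _ _ _ (by simp) (by simp) (by simp)⟩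
lemma l2_H (k : ℤ) : lo (2 * k) 0 0 ∈ H := ⟨l2_mem k, lo_mem_Γ₂ _ _ _ (by simp) (by simp) (by simp)⟩
lemma l3_H (k : ℤ) : up 0 0 (2 * k) ∈ H := ⟨l3_mem k, up_mem_Γ₂ _ _ _ (by simp) (by simp) (by simp)⟩
lemma l4_H (k : ℤ) : lo 0 0 (2 * k) ∈ H := ⟨l4_mem k, lo_mem_Γ₂ _ _ _ (by simp) (by simp) (by simp)⟩
lemma s3_H (k : ℤ) : up 0 (2 * k) 0 ∈ H := ⟨s3_mem k, up_mem_Γ₂ _ _ _ (by simp) (by simp) (by simp)⟩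
lemma s4_H (k : ℤ) : lo 0 (2 * k) 0 ∈ H := ⟨s4_mem k, lo_mem_Γ₂ _ _ _ (by simp) (by simp) (by simp)⟩
lemma s1_H (k : ℤ) : sh1 (2 * k) ∈ H := ⟨s1_mem k, sh1_mem_Γ₂ _ (by simp)⟩
lemma s2_H (k : ℤ) : sh2 (2 * k) ∈ H := ⟨s2_mem k, sh2_mem_Γ₂ _ (by simp)⟩
lemma neg1_H : neg1 ∈ H := ⟨neg1_mem, neg1_mem_Γ₂⟩
lemma neg2_H : neg2 ∈ H := ⟨neg2_mem, neg2_mem_Γ₂⟩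

/-- Integer column vectors. -/
def vec (x₁ x₂ y₁ y₂ : ℤ) : Fin 2 ⊕ Fin 2 → ℤ := Sum.elim ![x₁, x₂] ![y₁, y₂]

lemma vec_eta (v : Fin 2 ⊕ Fin 2 → ℤ) :
    v = vec (v (.inl 0)) (v (.inl 1)) (v (.inr 0)) (v (.inr 1)) := by
  ext i; rcases i with i | i <;> fin_cases i <;> rfl

lemma vec_inj {a b c d a' b' c' d' : ℤ} (h : vec a b c d = vec a' b' c' d') :
    a = a' ∧ b = b' ∧ c = c' ∧ d = d' :=
  ⟨congrFun h (.inl 0), congrFun h (.inl 1), congrFun h (.inr 0), congrFun h (.inr 1)⟩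

lemma up_vec (p q s x₁ x₂ y₁ y₂ : ℤ) : (up p q s).1 *ᵥ vec x₁ x₂ y₁ y₂ =
    vec (x₁ + p * y₁ + q * y₂) (x₂ + q * y₁ + s * y₂) y₁ y₂ := by
  ext i; rcases i with i | i <;> fin_cases i <;>
    simp [up, mkSp, vec, Matrix.mulVec, dotProduct, Fin.sum_univ_two] <;> ring
lemma lo_vec (p q s x₁ x₂ y₁ y₂ : ℤ) : (lo p q s).1 *ᵥ vec x₁ x₂ y₁ y₂ =
    vec x₁ x₂ (y₁ + p * x₁ + q * x₂) (y₂ + q * x₁ + s * x₂) := by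
  ext i; rcases i with i | i <;> fin_cases i <;>
    simp [lo, mkSp, vec, Matrix.mulVec, dotProduct, Fin.sum_univ_two] <;> ring
lemma sh1_vec (k x₁ x₂ y₁ y₂ : ℤ) : (sh1 k).1 *ᵥ vec x₁ x₂ y₁ y₂ =
    vec (x₁ + k * x₂) x₂ y₁ (y₂ + (-k) * y₁) := by
  ext i; rcases i with i | i <;> fin_cases i <;>
    simp [sh1, mkSp, vec, Matrix.mulVec, dotProduct, Fin.sum_univ_two] <;> ring
lemma sh2_vec (k x₁ x₂ y₁ y₂ : ℤ) : (sh2 k).1 *ᵥ vec x₁ x₂ y₁ y₂ =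
    vec x₁ (x₂ + k * x₁) (y₁ + (-k) * y₂) y₂ := by
  ext i; rcases i with i | i <;> fin_cases i <;>
    simp [sh2, mkSp, vec, Matrix.mulVec, dotProduct, Fin.sum_univ_two] <;> ring
lemma neg1_vec (x₁ x₂ y₁ y₂ : ℤ) : neg1.1 *ᵥ vec x₁ x₂ y₁ y₂ = vec (-x₁) x₂ (-y₁) y₂ := by
  ext i; rcases i with i | i <;> fin_cases i <;>
    simp [neg1, mkSp, vec, Matrix.mulVec, dotProduct, Fin.sum_univ_two]
lemma neg2_vec (x₁ x₂ y₁ y₂ : ℤ) : neg2.1 *ᵥ vec x₁ x₂ y₁ y₂ = vec x₁ (-x₂) y₁ (-y₂) := by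
  ext i; rcases i with i | i <;> fin_cases i <;>
    simp [neg2, mkSp, vec, Matrix.mulVec, dotProduct, Fin.sum_univ_two]

lemma mul_vec (g h : Sp) (v : Fin 2 ⊕ Fin 2 → ℤ) : (g * h).1 *ᵥ v = g.1 *ᵥ (h.1 *ᵥ v) := by
  rw [Matrix.mulVec_mulVec]; rfl

/-- The columns of a symplectic matrix. -/
def cl (g : Sp) (j : Fin 2 ⊕ Fin 2) : Fin 2 ⊕ Fin 2 → ℤ := fun i => g.1 i j

lemma cl_mul (g h : Sp) (j : Fin 2 ⊕ Fin 2) : cl (g * h) j = g.1 *ᵥ cl h j := rfl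

lemma cl_symp (M : Sp) (i j : Fin 2 ⊕ Fin 2) {a b c d a' b' c' d' : ℤ}
    (h : cl M i = vec a b c d) (h' : cl M j = vec a' b' c' d') :
    c * a' + d * b' - a * c' - b * d' = Matrix.J (Fin 2) ℤ i j := by
  rw [← SymplecticGroup.mem_iff'.1 M.2]
  have e (k) : M.1 k i = vec a b c d k := congrFun h k
  have e' (k) : M.1 k j = vec a' b' c' d' k := congrFun h' k
  simp [Matrix.mul_apply, Fin.sum_univ_two, e, e', Matrix.J, vec]
  ring

lemma odd_of_cast {z : ℤ} (h : (z : ZMod 2) = 1) : Odd z := ZMod.intCast_eq_one_iff_odd.1 h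
lemma even_of_cast {z : ℤ} (h : (z : ZMod 2) = 0) : Even z := ZMod.intCast_eq_zero_iff_even.1 h

lemma col_one (M : Sp) (hM : M ∈ Γ₂) : ∃ h ∈ H, cl (h * M) (.inl 0) = vec 1 0 0 0 := by
  have key : ∀ x₁ x₂ y₁ y₂ : ℤ, Odd x₁ → Even x₂ → Even y₁ → Even y₂ →
      ∃ h ∈ H, ∃ a, h.1 *ᵥ vec x₁ x₂ y₁ y₂ = vec a 0 0 0 := by
    intro x₁ x₂ y₁ y₂
    have st : ∀ g ∈ H, ∀ v v', g.1 *ᵥ v = v' → (∃ h ∈ H, ∃ a, h.1 *ᵥ v' = vec a 0 0 0) →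
        (∃ h ∈ H, ∃ a, h.1 *ᵥ v = vec a 0 0 0) := by
      rintro g hg v v' rfl ⟨h, hh, a, ha⟩
      exact ⟨h * g, H.mul_mem hh hg, a, by rw [mul_vec, ha]⟩
    refine euclid_four (fun x₁ x₂ y₁ y₂ => ∃ h ∈ H, ∃ a, h.1 *ᵥ vec x₁ x₂ y₁ y₂ = vec a 0 0 0)
      ?_ ?_ ?_ ?_ ?_ ?_ ?_ _ x₁ x₂ y₁ y₂ rfl
    · intro k x₁ x₂ y₁ y₂
      exact st _ (l1_H k) _ _ (by rw [up_vec]; congr 1 <;> ring)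
    · intro k x₁ x₂ y₁ y₂
      exact st _ (l2_H k) _ _ (by rw [lo_vec]; congr 1 <;> ring)
    · intro k x₁ x₂ y₁ y₂
      exact st _ (s1_H k) _ _ (by rw [sh1_vec]; congr 1; ring)
    · intro k x₁ x₂ y₁ y₂
      exact st _ (s2_H k) _ _ (by rw [sh2_vec]; congr 1; ring)
    · intro k x₁ x₂ y₁ y₂
      exact st _ (s3_H k) _ _ (by rw [up_vec]; congr 1 <;> ring)
    · intro k x₁ x₂ y₁ y₂
      exact st _ (s4_H k) _ _ (by rw [lo_vec]; congr 1 <;> ring)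
    · intro a
      exact ⟨1, H.one_mem, a, by simp⟩
  rw [mem_Γ₂_iff] at hM
  obtain ⟨h, hh, a, ha⟩ := key (M.1 (.inl 0) (.inl 0)) (M.1 (.inl 1) (.inl 0))
    (M.1 (.inr 0) (.inl 0)) (M.1 (.inr 1) (.inl 0))
    (odd_of_cast (by rw [hM]; rfl)) (even_of_cast (by rw [hM]; rfl))
    (even_of_cast (by rw [hM]; rfl)) (even_of_cast (by rw [hM]; rfl))
  have e : cl (h * M) (.inl 0) = vec a 0 0 0 := by
    rw [cl_mul, ← ha, vec_eta (cl M (.inl 0))]; rfl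
  have sy := cl_symp (h * M) (.inl 0) (.inr 0) e (vec_eta _)
  have hJ : Matrix.J (Fin 2) ℤ (.inl 0) (.inr 0) = -1 := by decide
  rw [hJ] at sy
  have : IsUnit a := IsUnit.of_mul_eq_one (cl (h * M) (.inr 0) (.inr 0)) (by linarith)
  rcases Int.isUnit_iff.1 this with rfl | rfl
  · exact ⟨h, hh, e⟩
  · refine ⟨neg1 * h, H.mul_mem neg1_H hh, ?_⟩
    rw [mul_assoc, cl_mul, e, neg1_vec]; simp

lemma H_mul_mem_Γ₂ {h M : Sp} (hh : h ∈ H) (hM : M ∈ Γ₂) : h * M ∈ Γ₂ := Γ₂.mul_mem hh.2 hM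

lemma col_three (M : Sp) (hM : M ∈ Γ₂) (h1 : cl M (.inl 0) = vec 1 0 0 0) :
    ∃ h ∈ H, cl (h * M) (.inl 0) = vec 1 0 0 0 ∧ cl (h * M) (.inr 0) = vec 0 0 1 0 := by
  have sy := cl_symp M (.inl 0) (.inr 0) h1 (vec_eta _)
  have hJ : Matrix.J (Fin 2) ℤ (.inl 0) (.inr 0) = -1 := by decide
  rw [hJ] at sy
  have e := vec_eta (cl M (.inr 0))
  have e3 : cl M (.inr 0) (.inr 0) = 1 := by linarith
  rw [e3] at e
  rw [mem_Γ₂_iff] at hM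
  obtain ⟨p, hp⟩ := even_iff_two_dvd.1 (even_of_cast ((hM (.inl 0) (.inr 0)).trans rfl))
  obtain ⟨q, hq⟩ := even_iff_two_dvd.1 (even_of_cast ((hM (.inl 1) (.inr 0)).trans rfl))
  obtain ⟨s, hs⟩ := even_iff_two_dvd.1 (even_of_cast ((hM (.inr 1) (.inr 0)).trans rfl))
  have e' : cl M (.inr 0) = vec (2 * p) (2 * q) 1 (2 * s) := by
    rw [e]; unfold cl; rw [hp, hq, hs]
  refine ⟨up (2 * (-(p - 2 * q * s))) 0 0 * (sh1 (2 * s) * up 0 (2 * (-q)) 0),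
    H.mul_mem (l1_H _) (H.mul_mem (s1_H _) (s3_H _)), ?_, ?_⟩
  · simp only [cl_mul, mul_vec, h1, up_vec, sh1_vec]
    congr 1 <;> ring
  · simp only [cl_mul, mul_vec, e', up_vec, sh1_vec]
    congr 1 <;> ring

lemma col_two (M : Sp) (hM : M ∈ Γ₂) (h1 : cl M (.inl 0) = vec 1 0 0 0)
    (h3 : cl M (.inr 0) = vec 0 0 1 0) :
    ∃ h ∈ H, cl (h * M) (.inl 0) = vec 1 0 0 0 ∧ cl (h * M) (.inr 0) = vec 0 0 1 0 ∧
      cl (h * M) (.inl 1) = vec 0 1 0 0 := by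
  have key : ∀ x y : ℤ, Odd x → Even y →
      ∃ h ∈ H, h.1 *ᵥ vec 1 0 0 0 = vec 1 0 0 0 ∧ h.1 *ᵥ vec 0 0 1 0 = vec 0 0 1 0 ∧
        ∃ a, h.1 *ᵥ vec 0 x 0 y = vec 0 a 0 0 := by
    intro x y
    have st : ∀ g ∈ H, ∀ v v', g.1 *ᵥ vec 1 0 0 0 = vec 1 0 0 0 →
        g.1 *ᵥ vec 0 0 1 0 = vec 0 0 1 0 → g.1 *ᵥ v = v' →
        (∃ h ∈ H, h.1 *ᵥ vec 1 0 0 0 = vec 1 0 0 0 ∧ h.1 *ᵥ vec 0 0 1 0 = vec 0 0 1 0 ∧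
          ∃ a, h.1 *ᵥ v' = vec 0 a 0 0) →
        (∃ h ∈ H, h.1 *ᵥ vec 1 0 0 0 = vec 1 0 0 0 ∧ h.1 *ᵥ vec 0 0 1 0 = vec 0 0 1 0 ∧
          ∃ a, h.1 *ᵥ v = vec 0 a 0 0) := by
      rintro g hg v v' g1 g2 rfl ⟨h, hh, h1, h2, a, ha⟩
      exact ⟨h * g, H.mul_mem hh hg, by rw [mul_vec, g1, h1], by rw [mul_vec, g2, h2], a,
        by rw [mul_vec, ha]⟩
    refine euclid_two (fun x y => ∃ h ∈ H, h.1 *ᵥ vec 1 0 0 0 = vec 1 0 0 0 ∧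
        h.1 *ᵥ vec 0 0 1 0 = vec 0 0 1 0 ∧ ∃ a, h.1 *ᵥ vec 0 x 0 y = vec 0 a 0 0)
      ?_ ?_ ?_ _ x y rfl
    · intro k x y
      exact st _ (l3_H k) _ _ (by simp [up_vec]) (by simp [up_vec])
        (by rw [up_vec]; congr 1 <;> ring)
    · intro k x y
      exact st _ (l4_H k) _ _ (by simp [lo_vec]) (by simp [lo_vec])
        (by rw [lo_vec]; congr 1 <;> ring)
    · intro a
      exact ⟨1, H.one_mem, by simp, by simp, a, by simp⟩
  have sy1 := cl_symp M (.inl 0) (.inl 1) h1 (vec_eta _)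
  have sy3 := cl_symp M (.inr 0) (.inl 1) h3 (vec_eta _)
  rw [show Matrix.J (Fin 2) ℤ (.inl 0) (.inl 1) = 0 by decide] at sy1
  rw [show Matrix.J (Fin 2) ℤ (.inr 0) (.inl 1) = 0 by decide] at sy3
  have e := vec_eta (cl M (.inl 1))
  rw [show cl M (.inl 1) (.inl 0) = 0 by linarith,
    show cl M (.inl 1) (.inr 0) = 0 by linarith] at e
  rw [mem_Γ₂_iff] at hM
  obtain ⟨h, hh, f1, f3, a, ha⟩ := key (cl M (.inl 1) (.inl 1)) (cl M (.inl 1) (.inr 1))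
    (odd_of_cast ((hM (.inl 1) (.inl 1)).trans rfl))
    (even_of_cast ((hM (.inr 1) (.inl 1)).trans rfl))
  have e1 : cl (h * M) (.inl 0) = vec 1 0 0 0 := by rw [cl_mul, h1, f1]
  have e3 : cl (h * M) (.inr 0) = vec 0 0 1 0 := by rw [cl_mul, h3, f3]
  have e2 : cl (h * M) (.inl 1) = vec 0 a 0 0 := by rw [cl_mul, e, ha]
  have sy := cl_symp (h * M) (.inl 1) (.inr 1) e2 (vec_eta _)
  rw [show Matrix.J (Fin 2) ℤ (.inl 1) (.inr 1) = -1 by decide] at sy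
  have : IsUnit a := IsUnit.of_mul_eq_one (cl (h * M) (.inr 1) (.inr 1)) (by linarith)
  rcases Int.isUnit_iff.1 this with rfl | rfl
  · exact ⟨h, hh, e1, e3, e2⟩
  · refine ⟨neg2 * h, H.mul_mem neg2_H hh, ?_, ?_, ?_⟩
    · rw [mul_assoc, cl_mul, e1, neg2_vec]; simp
    · rw [mul_assoc, cl_mul, e3, neg2_vec]; simp
    · rw [mul_assoc, cl_mul, e2, neg2_vec]; simp

lemma col_four (M : Sp) (hM : M ∈ Γ₂) (h1 : cl M (.inl 0) = vec 1 0 0 0)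
    (h3 : cl M (.inr 0) = vec 0 0 1 0) (h2 : cl M (.inl 1) = vec 0 1 0 0) : M ∈ Γ := by
  have sy1 := cl_symp M (.inl 0) (.inr 1) h1 (vec_eta _)
  have sy3 := cl_symp M (.inr 0) (.inr 1) h3 (vec_eta _)
  have sy2 := cl_symp M (.inl 1) (.inr 1) h2 (vec_eta _)
  rw [show Matrix.J (Fin 2) ℤ (.inl 0) (.inr 1) = 0 by decide] at sy1
  rw [show Matrix.J (Fin 2) ℤ (.inr 0) (.inr 1) = 0 by decide] at sy3
  rw [show Matrix.J (Fin 2) ℤ (.inl 1) (.inr 1) = -1 by decide] at sy2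
  rw [mem_Γ₂_iff] at hM
  obtain ⟨p, hp⟩ := even_iff_two_dvd.1 (even_of_cast ((hM (.inl 1) (.inr 1)).trans rfl))
  have e := vec_eta (cl M (.inr 1))
  rw [show cl M (.inr 1) (.inl 0) = 0 by linarith,
    show cl M (.inr 1) (.inr 0) = 0 by linarith, show cl M (.inr 1) (.inr 1) = 1 by linarith,
    show cl M (.inr 1) (.inl 1) = 2 * p from hp] at e
  have : M = up 0 0 (2 * p) := by
    apply Subtype.ext
    ext i j
    change cl M j i = cl (up 0 0 (2 * p)) j i
    rcases j with j | j <;> fin_cases j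
    · change cl M (.inl 0) i = _
      rw [h1]
      rcases i with i | i <;> fin_cases i <;> simp [vec, cl, up, mkSp]
    · change cl M (.inl 1) i = _
      rw [h2]
      rcases i with i | i <;> fin_cases i <;> simp [vec, cl, up, mkSp]
    · change cl M (.inr 0) i = _
      rw [h3]
      rcases i with i | i <;> fin_cases i <;> simp [vec, cl, up, mkSp]
    · change cl M (.inr 1) i = _
      rw [e]
      rcases i with i | i <;> fin_cases i <;> simp [vec, cl, up, mkSp]
  rw [this]
  exact l3_mem p

theorem Γ₂_le : Γ₂ ≤ Γ := by
  intro M hM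
  obtain ⟨h, hh, h1⟩ := col_one M hM
  have hM1 := H_mul_mem_Γ₂ hh hM
  obtain ⟨h', hh', h1, h3⟩ := col_three _ hM1 h1
  have hM2 := H_mul_mem_Γ₂ hh' hM1
  obtain ⟨h'', hh'', h1, h3, h2⟩ := col_two _ hM2 h1 h3
  have := col_four _ (H_mul_mem_Γ₂ hh'' hM2) h1 h3 h2
  exact (Γ.mul_mem_cancel_left hh.1).1 ((Γ.mul_mem_cancel_left hh'.1).1
    ((Γ.mul_mem_cancel_left hh''.1).1 this))

/-! ### The image modulo two -/

/-- Five vectors of `𝔽₂⁴` permuted by the image of `Γ`. -/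
def WW : Matrix (Fin 2 ⊕ Fin 2) (Fin 5) (ZMod 2) :=
  Matrix.of (Sum.elim ![![1,1,0,0,0], ![0,0,1,1,0]] ![![0,1,1,1,1], ![0,0,0,1,1]])

/-- A right inverse of `WW`. -/
def LL : Matrix (Fin 5) (Fin 2 ⊕ Fin 2) (ZMod 2) :=
  (Matrix.of (Sum.elim ![![1,0,0,0,0], ![1,1,1,0,0]] ![![1,1,0,0,0], ![0,0,1,1,0]]))ᵀ

def PP (σ : Equiv.Perm (Fin 5)) : Matrix (Fin 5) (Fin 5) (ZMod 2) :=
  Matrix.of fun i j => if i = σ j then 1 else 0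

def UU (z : Fin 5 → ZMod 2) : Matrix (Fin 5) (Fin 5) (ZMod 2) := Matrix.of fun _ j => z j

def GG : Matrix (Fin 5) (Fin 5) (ZMod 2) := Matrix.of fun i j => if i = j then 0 else 1

lemma WL : WW * LL = 1 := by decide +kernel
lemma LW : LL * WW = 1 + UU ![0,0,0,0,1] := by decide +kernel
lemma WU (z : Fin 5 → ZMod 2) : WW * UU z = 0 := by
  ext i j
  have : ∀ i, ∑ k, WW i k = 0 := by decide +kernel
  simp [Matrix.mul_apply, UU, ← Finset.sum_mul, this]
lemma WJW : WWᵀ * Matrix.J (Fin 2) (ZMod 2) * WW = GG := by decide +kernel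
lemma LGL : LLᵀ * GG * LL = Matrix.J (Fin 2) (ZMod 2) := by decide +kernel

lemma PP_mul (σ τ : Equiv.Perm (Fin 5)) : PP σ * PP τ = PP (σ * τ) := by
  ext i j
  simp [PP, Matrix.mul_apply]
  congr
lemma PP_one : PP 1 = 1 := by
  ext i j
  simp [PP, Matrix.one_apply]
  congr
lemma PP_UU (σ : Equiv.Perm (Fin 5)) (z : Fin 5 → ZMod 2) : PP σ * UU z = UU z := by
  ext i j
  have : ∀ x, (i = σ x) ↔ (x = σ.symm i) := fun x => by
    rw [Equiv.eq_symm_apply, eq_comm]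
  simp [PP, UU, Matrix.mul_apply, this]
lemma PP_GG (σ : Equiv.Perm (Fin 5)) : (PP σ)ᵀ * GG * PP σ = GG := by
  have h : (PP σ)ᵀ * GG = Matrix.of fun i k => if σ i = k then 0 else 1 := by
    ext i k
    simp only [PP, GG, Matrix.mul_apply, Matrix.transpose_apply, Matrix.of_apply, ite_mul, one_mul,
      zero_mul, Finset.sum_ite_eq', Finset.mem_univ, if_true]
  rw [h]
  ext i j
  simp only [PP, GG, Matrix.mul_apply, Matrix.of_apply, mul_ite, mul_one, mul_zero]
  rw [Finset.sum_ite_eq']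
  simp

lemma WPLW (σ : Equiv.Perm (Fin 5)) : WW * PP σ * LL * WW = WW * PP σ := by
  rw [Matrix.mul_assoc, LW, Matrix.mul_add, Matrix.mul_one, Matrix.mul_assoc, PP_UU, WU, add_zero]

/-- The representation of `S₅` on `𝔽₂⁴`. -/
def rho : Equiv.Perm (Fin 5) →* Matrix.symplecticGroup (Fin 2) (ZMod 2) where
  toFun σ := ⟨WW * PP σ * LL, by
    rw [SymplecticGroup.mem_iff']
    calc (WW * PP σ * LL)ᵀ * Matrix.J (Fin 2) (ZMod 2) * (WW * PP σ * LL)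
        = LLᵀ * ((PP σ)ᵀ * (WWᵀ * Matrix.J (Fin 2) (ZMod 2) * WW) * PP σ) * LL := by
          simp only [Matrix.transpose_mul, Matrix.mul_assoc]
      _ = _ := by rw [WJW, PP_GG, LGL]⟩
  map_one' := by
    apply Subtype.ext
    change WW * PP 1 * LL = 1
    rw [PP_one, Matrix.mul_one, WL]
  map_mul' σ τ := by
    apply Subtype.ext
    change WW * PP (σ * τ) * LL = WW * PP σ * LL * (WW * PP τ * LL)
    have e : WW * PP σ * LL * (WW * PP τ * LL) = WW * PP σ * LL * WW * (PP τ * LL) := by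
      simp only [Matrix.mul_assoc]
    rw [e, WPLW, ← PP_mul]
    simp only [Matrix.mul_assoc]

lemma rho_injective : Function.Injective rho := by
  intro σ τ h
  have h1 : WW * PP σ * LL = WW * PP τ * LL := congrArg Subtype.val h
  have h2 : WW * PP σ = WW * PP τ := by rw [← WPLW σ, ← WPLW τ, h1]
  have inj : ∀ a b : Fin 5, (∀ i, WW i a = WW i b) → a = b := by decide +kernel
  ext1 j
  apply inj
  intro i
  have h3 := congrFun (congrFun h2 i) j
  simpa [PP, Matrix.mul_apply] using h3

lemma rho_A : rho (Equiv.swap 0 1) = sred gA := by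
  apply Subtype.ext; change WW * PP _ * LL = gA.1.map (fun x : ℤ => (x : ZMod 2)); decide +kernel
lemma rho_B : rho (Equiv.swap 1 2) = sred gB := by
  apply Subtype.ext; change WW * PP _ * LL = gB.1.map (fun x : ℤ => (x : ZMod 2)); decide +kernel
lemma rho_C : rho (Equiv.swap 2 3) = sred gC := by
  apply Subtype.ext; change WW * PP _ * LL = gC.1.map (fun x : ℤ => (x : ZMod 2)); decide +kernel
lemma rho_D : rho (Equiv.swap 3 4) = sred gD := by
  apply Subtype.ext; change WW * PP _ * LL = gD.1.map (fun x : ℤ => (x : ZMod 2)); decide +kernel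

lemma perm_closure : Subgroup.closure ({Equiv.swap 0 1, Equiv.swap 1 2, Equiv.swap 2 3,
    Equiv.swap 3 4} : Set (Equiv.Perm (Fin 5))) = ⊤ := by
  rw [eq_top_iff]
  intro σ _
  have h := Equiv.Perm.mclosure_swap_castSucc_succ 4
  have hσ : σ ∈ Submonoid.closure (Set.range fun i : Fin 4 => Equiv.swap i.castSucc i.succ) := by
    rw [h]; trivial
  refine (Submonoid.closure_le (S := (Subgroup.closure ({Equiv.swap 0 1, Equiv.swap 1 2,
    Equiv.swap 2 3, Equiv.swap 3 4} : Set (Equiv.Perm (Fin 5)))).toSubmonoid)).2 ?_ hσ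
  rintro _ ⟨i, rfl⟩
  apply Subgroup.subset_closure
  fin_cases i
  · exact Or.inl rfl
  · exact Or.inr (Or.inl rfl)
  · exact Or.inr (Or.inr (Or.inl rfl))
  · exact Or.inr (Or.inr (Or.inr rfl))

lemma rho_range : rho.range = Γ.map sred := by
  rw [MonoidHom.range_eq_map, ← perm_closure, MonoidHom.map_closure, Γ_eq, MonoidHom.map_closure]
  simp only [Set.image_insert_eq, Set.image_singleton, rho_A, rho_B, rho_C, rho_D]

/-- The image of `Γ` modulo two is `S₅`. -/
noncomputable def imageEquiv : Γ.map sred ≃* Equiv.Perm (Fin 5) :=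
  ((MonoidHom.ofInjective rho_injective).trans (MulEquiv.subgroupCongr rho_range)).symm

/-- `Γ(2)` is a normal subgroup of `Γ` and the quotient `Γ/Γ(2)` is isomorphic to the
symmetric group `S₅`; equivalently, the image of `Γ` under the reduction homomorphism
`Sp(4,ℤ) → Sp(4,ℤ/2ℤ)` is a group of order `120` isomorphic to `S₅`. -/
theorem gamma_mod_gamma2 :
    Γ₂ ≤ Γ ∧ (Γ₂.subgroupOf Γ).Normal ∧
    Nonempty ((Γ ⧸ Γ₂.subgroupOf Γ) ≃* Equiv.Perm (Fin 5)) ∧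
    Nat.card (Γ.map sred) = 120 ∧
    Nonempty (Γ.map sred ≃* Equiv.Perm (Fin 5)) := by
  refine ⟨Γ₂_le, inferInstance, ?_, ?_, ⟨imageEquiv⟩⟩
  · have hk : Γ₂.subgroupOf Γ = (sred.domRestrict Γ).ker := (MonoidHom.ker_domRestrict Γ sred).symm
    have hr : (sred.domRestrict Γ).range = Γ.map sred := MonoidHom.domRestrict_range Γ sred
    exact ⟨(QuotientGroup.quotientMulEquivOfEq hk).trans
      ((QuotientGroup.quotientKerEquivRange (sred.domRestrict Γ)).trans
        ((MulEquiv.subgroupCongr hr).trans imageEquiv))⟩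
  · rw [Nat.card_congr imageEquiv.toEquiv, Nat.card_perm, Nat.card_fin]
    rfl

end GenusTwo
end
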